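/- Let v be a nonconstant real analytic function on 𝕋 (a 1-periodic real analytic function on ℝ). Then there exists λ₀ = λ₀(v) such that for every λ > λ₀, every irrational ω, and every energy E ∈ ℝ, the Lyapunov exponent satisfies γ(E) > (1/2)·ln λ. -/

import Mathlib

open MeasureTheory Filter

noncomputable section

/-- The Frobenius norm of a 2×2 real matrix. -/
def matNorm (M : Matrix (Fin 2) (Fin 2) ℝ) : ℝ := Real.sqrt (∑ i, ∑ j, (M i j) ^ 2)

/-- The `k`-step transfer matrix `M_k(θ,E) = ∏_{n=k-1}^{0} A(θ + nω, E)` of the quasiperiodic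
Schrödinger cocycle with potential `λ v`, where `A(θ,E) = [[E - λ v(θ), -1],[1,0]]`. -/
def transfer (v : ℝ → ℝ) (lam E ω θ : ℝ) : ℕ → Matrix (Fin 2) (Fin 2) ℝ
  | 0 => 1
  | (k + 1) => !![E - lam * v (θ + (k : ℝ) * ω), -1; 1, 0] * transfer v lam E ω θ k

/-- `γ` is the Lyapunov exponent at energy `E`:
`γ = lim_{k→∞} (1/k) ∫_𝕋 log ‖M_k(θ,E)‖ dθ`. -/
def HasLyapunov (v : ℝ → ℝ) (lam E ω : ℝ) (γ : ℝ) : Prop :=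
  Tendsto (fun k : ℕ => (1 / (k : ℝ)) *
      ∫ θ in Set.Icc (0 : ℝ) 1, Real.log (matNorm (transfer v lam E ω θ k)))
    atTop (nhds γ)

/-! ### Maximum principle for functions dominated by their vertical averages -/

/-- A continuous function on `[0, ρ]` which is bounded by its averages along `y + r sin θ` lies
below its chord. -/
theorem le_chord_of_le_sin_average {L : ℝ → ℝ} (hL : Continuous L) {ρ : ℝ} (hρ : 0 < ρ)
    (hmean : ∀ y r : ℝ, 0 < r → r ≤ y → r ≤ ρ - y →
      2 * Real.pi * L y ≤ ∫ θ in (0 : ℝ)..2 * Real.pi, L (y + r * Real.sin θ))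
    {y : ℝ} (hy0 : 0 ≤ y) (hyρ : y ≤ ρ) :
    L y ≤ (1 - y / ρ) * L 0 + y / ρ * L ρ := by
  set D : ℝ → ℝ := fun t => L t - ((1 - t / ρ) * L 0 + t / ρ * L ρ) with hD
  have hDc : Continuous D := by fun_prop
  have hD0 : D 0 = 0 := by simp [hD]
  have hDρ : D ρ = 0 := by simp [hD, hρ.ne']
  have hDmean : ∀ y r : ℝ, 0 < r → r ≤ y → r ≤ ρ - y →
      2 * Real.pi * D y ≤ ∫ θ in (0 : ℝ)..2 * Real.pi, D (y + r * Real.sin θ) := by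
    intro y r hr h1 h2
    have haff : ∀ θ : ℝ, D (y + r * Real.sin θ) = L (y + r * Real.sin θ) -
        (((1 - y / ρ) * L 0 + y / ρ * L ρ) + (r / ρ * (L ρ - L 0)) * Real.sin θ) := by
      intro θ; simp only [hD]; ring
    simp_rw [haff]
    rw [intervalIntegral.integral_sub (by apply Continuous.intervalIntegrable; fun_prop)
      (by apply Continuous.intervalIntegrable; fun_prop),
      intervalIntegral.integral_add (by simp) (by apply Continuous.intervalIntegrable; fun_prop),
      intervalIntegral.integral_const_mul]
    simp only [intervalIntegral.integral_const, integral_sin, Real.cos_two_pi, Real.cos_zero,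
      sub_zero, smul_eq_mul, sub_self, mul_zero, add_zero]
    have := hmean y r hr h1 h2
    simp only [hD]
    linarith
  obtain ⟨z, hz, hzmax⟩ := isCompact_Icc.exists_isMaxOn (Set.nonempty_Icc.2 hρ.le)
    hDc.continuousOn
  have hKc : IsCompact (Set.Icc 0 ρ ∩ D ⁻¹' {D z}) :=
    isCompact_Icc.inter_right (isClosed_singleton.preimage hDc)
  obtain ⟨w, ⟨hw, hwz⟩, hwmax⟩ := hKc.exists_isGreatest ⟨z, hz, rfl⟩
  have hwz : D w = D z := hwz
  suffices D z ≤ 0 by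
    have h := hzmax (show y ∈ Set.Icc 0 ρ from ⟨hy0, hyρ⟩)
    simp only [Set.mem_ofPred_eq] at h
    have : D y ≤ 0 := h.trans this
    simp only [hD] at this
    linarith
  by_contra! hpos
  have hw0 : 0 < w := lt_of_le_of_ne hw.1 (by rintro rfl; linarith)
  have hwρ : w < ρ := lt_of_le_of_ne hw.2 (by rintro rfl; linarith)
  set r := min w (ρ - w) with hr
  have hr0 : 0 < r := lt_min hw0 (by linarith)
  have hr1 : r ≤ w := min_le_left _ _
  have hr2 : r ≤ ρ - w := min_le_right _ _
  have hmem : ∀ θ : ℝ, w + r * Real.sin θ ∈ Set.Icc 0 ρ := by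
    intro θ
    have h1 := Real.neg_one_le_sin θ
    have h2 := Real.sin_le_one θ
    constructor <;> nlinarith
  have hint : 0 < ∫ θ in (0 : ℝ)..2 * Real.pi, (D z - D (w + r * Real.sin θ)) := by
    refine intervalIntegral.integral_pos Real.two_pi_pos (by fun_prop)
      (fun θ _ => sub_nonneg.2 (hzmax (hmem θ))) ⟨Real.pi / 2, ?_, ?_⟩
    · constructor <;> linarith [Real.pi_pos]
    · rw [sub_pos]
      refine lt_of_le_of_ne (hzmax (hmem _)) fun h => ?_
      have := hwmax ⟨hmem (Real.pi / 2), h⟩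
      rw [Real.sin_pi_div_two] at this
      linarith
  rw [intervalIntegral.integral_sub (by simp)
    (by apply Continuous.intervalIntegrable; fun_prop)] at hint
  have := hDmean w r hr0 hr1 hr2
  simp only [intervalIntegral.integral_const, sub_zero, smul_eq_mul] at hint
  rw [hwz] at this
  linarith

/-- The horizontal means of a continuous function which is `1`-periodic in the real direction and
subharmonic in the strip `0 < im z < ρ` are convex in the imaginary direction. -/
theorem horizontal_mean_le_chord {u : ℂ → ℝ} (hu : Continuous u) (hper : ∀ z, u (z + 1) = u z)
    {ρ : ℝ} (hρ : 0 < ρ)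
    (hsub : ∀ (c : ℂ) (r : ℝ), 0 < r → r ≤ c.im → r ≤ ρ - c.im → u c ≤ Real.circleAverage u c r)
    {y : ℝ} (hy0 : 0 ≤ y) (hyρ : y ≤ ρ) :
    ∫ x in (0 : ℝ)..1, u (x + y * Complex.I) ≤
      (1 - y / ρ) * (∫ x in (0 : ℝ)..1, u x) +
        y / ρ * ∫ x in (0 : ℝ)..1, u (x + ρ * Complex.I) := by
  set L : ℝ → ℝ := fun y => ∫ x in (0 : ℝ)..1, u (x + y * Complex.I) with hLdef
  have hL : Continuous L := by
    apply intervalIntegral.continuous_parametric_intervalIntegral_of_continuous' (μ := volume)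
      (f := fun (y x : ℝ) => u (x + y * Complex.I))
    simp only [Function.uncurry_def]
    fun_prop
  have key : L y ≤ (1 - y / ρ) * L 0 + y / ρ * L ρ := by
    refine le_chord_of_le_sin_average hL hρ (fun y r hr h1 h2 => ?_) hy0 hyρ
    have hshift : ∀ θ : ℝ, L (y + r * Real.sin θ) =
        ∫ x in (0 : ℝ)..1, u (circleMap (x + y * Complex.I) r θ) := by
      intro θ
      have hp : Function.Periodic
          (fun x : ℝ => u (x + (y + r * Real.sin θ : ℝ) * Complex.I)) 1 := by
        intro x
        simp only
        rw [← hper (x + _)]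
        congr 1
        push_cast; ring
      have h := hp.intervalIntegral_add_eq 0 (r * Real.cos θ)
      have h' := intervalIntegral.integral_comp_add_right (a := 0) (b := 1)
        (fun x : ℝ => u (x + (y + r * Real.sin θ : ℝ) * Complex.I)) (r * Real.cos θ)
      simp only [hLdef]
      rw [zero_add] at h h'
      rw [h, add_comm (r * Real.cos θ) 1, ← h']
      congr 1
      ext x
      congr 1
      rw [circleMap, Complex.exp_mul_I]
      push_cast; ring
    simp_rw [hshift]
    rw [intervalIntegral_intervalIntegral_swap, hLdef, ← intervalIntegral.integral_const_mul]
    · refine intervalIntegral.integral_mono_on zero_le_one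
        (by apply Continuous.intervalIntegrable; fun_prop) ?_ fun x _ => ?_
      · apply Continuous.intervalIntegrable
        apply intervalIntegral.continuous_parametric_intervalIntegral_of_continuous' (μ := volume)
          (f := fun (x : ℝ) θ => u (circleMap (x + y * Complex.I) r θ))
        simp only [Function.uncurry_def, circleMap]
        fun_prop
      · have := hsub (x + y * Complex.I) r hr (by simpa using h1) (by simpa using h2)
        rw [Real.circleAverage_def, smul_eq_mul, ← div_eq_inv_mul,
          le_div_iff₀ Real.two_pi_pos] at this
        linarith
    · have hcont : Continuous (Function.uncurry fun (θ x : ℝ) =>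
          u (circleMap (x + y * Complex.I) r θ)) := by
        simp only [Function.uncurry_def, circleMap]
        fun_prop
      exact (hcont.continuousOn.integrableOn_compact (isCompact_uIcc.prod isCompact_uIcc)).mono_set
        (Set.prod_mono Set.uIoc_subset_uIcc Set.uIoc_subset_uIcc)
  simpa [hLdef] using key

/-! ### Subharmonicity of the logarithm of the larger of two holomorphic functions -/

theorem log_norm_le_circleAverage_log_of_norm_le {f : ℂ → ℂ} {N : ℂ → ℝ} {c : ℂ} {r : ℝ}
    (hr : 0 < r) (hf : AnalyticOnNhd ℂ f (Metric.closedBall c r))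
    (hN : ContinuousOn N (Metric.closedBall c r)) (hpos : ∀ z ∈ Metric.closedBall c r, 0 < N z)
    (hle : ∀ z ∈ Metric.closedBall c r, ‖f z‖ ≤ N z) (hfc : f c ≠ 0) :
    Real.log ‖f c‖ ≤ Real.circleAverage (fun z => Real.log (N z)) c r := by
  have habs : |r| = r := abs_of_pos hr
  obtain ⟨m, hm, hmin⟩ := (isCompact_closedBall c r).exists_isMinOn
    ⟨c, Metric.mem_closedBall_self hr.le⟩ hN
  have hm0 := hpos m hm
  set g : ℂ → ℂ := fun z => f z / (N m : ℂ) with hg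
  have hga : AnalyticOnNhd ℂ g (Metric.closedBall c |r|) := by
    rw [habs]
    exact hf.div_const
  have hgc : g c ≠ 0 := div_ne_zero hfc (by exact_mod_cast hm0.ne')
  have hgn : ∀ z, ‖g z‖ = ‖f z‖ / N m := by
    intro z; simp [hg, abs_of_pos hm0]
  have hNi : CircleIntegrable (fun z => Real.log (N z)) c r := by
    refine ContinuousOn.circleIntegrable hr.le ?_
    exact ((hN.mono Metric.sphere_subset_closedBall).log
      fun z hz => (hpos z (Metric.sphere_subset_closedBall hz)).ne')
  have hgi : CircleIntegrable (fun z => Real.log ‖g z‖) c r :=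
    (hga.meromorphicOn.mono_set Metric.sphere_subset_closedBall).circleIntegrable_log_norm
  have hmono : Real.circleAverage (fun z => Real.log ‖g z‖) c r ≤
      Real.circleAverage (fun z => Real.log (N z) - Real.log (N m)) c r := by
    refine Real.circleAverage_mono hgi (hNi.sub (circleIntegrable_const _ _ _)) fun z hz => ?_
    rw [habs] at hz
    have hz' := Metric.sphere_subset_closedBall hz
    have hle' := hmin hz'
    simp only [Set.mem_ofPred_eq] at hle'
    rcases eq_or_ne (f z) 0 with h0 | h0
    · rw [hgn, h0]
      simpa using Real.log_le_log hm0 hle'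
    · rw [hgn, Real.log_div (norm_ne_zero_iff.2 h0) hm0.ne']
      have := Real.log_le_log (norm_pos_iff.2 h0) (hle z hz')
      linarith
  have hjensen : Real.log ‖g c‖ ≤ Real.circleAverage (fun z => Real.log ‖g z‖) c r := by
    rw [hga.circleAverage_log_norm hr.ne' hgc]
    refine le_add_of_nonneg_left (finsum_nonneg fun u => ?_)
    by_cases hu : u ∈ Metric.closedBall c |r|
    · refine mul_nonneg ?_ ?_
      · exact_mod_cast (MeromorphicOn.AnalyticOnNhd.divisor_nonneg hga) u
      · rcases eq_or_ne u c with rfl | huc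
        · simp
        · apply Real.log_nonneg
          rw [← div_eq_mul_inv, one_le_div (norm_pos_iff.2 (sub_ne_zero.2 huc.symm))]
          rw [habs, Metric.mem_closedBall, dist_comm, dist_eq_norm] at hu
          exact hu
    · simp [hu]
  rw [Real.circleAverage_fun_sub hNi (circleIntegrable_const _ _ _),
    Real.circleAverage_const] at hmono
  rw [hgn, Real.log_div (norm_ne_zero_iff.2 hfc) hm0.ne'] at hjensen
  linarith

theorem log_max_norm_le_circleAverage {f g : ℂ → ℂ} {c : ℂ} {r : ℝ}
    (hr : 0 < r) (hf : AnalyticOnNhd ℂ f (Metric.closedBall c r))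
    (hg : AnalyticOnNhd ℂ g (Metric.closedBall c r))
    (hpos : ∀ z ∈ Metric.closedBall c r, 0 < max ‖f z‖ ‖g z‖) :
    Real.log (max ‖f c‖ ‖g c‖) ≤
      Real.circleAverage (fun z => Real.log (max ‖f z‖ ‖g z‖)) c r := by
  have hN : ContinuousOn (fun z => max ‖f z‖ ‖g z‖) (Metric.closedBall c r) :=
    ContinuousOn.sup hf.continuousOn.norm hg.continuousOn.norm
  have hc := hpos c (Metric.mem_closedBall_self hr.le)
  rcases max_cases ‖f c‖ ‖g c‖ with ⟨h, -⟩ | ⟨h, -⟩ <;> rw [h] at hc ⊢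
  · exact log_norm_le_circleAverage_log_of_norm_le hr hf hN hpos
      (fun z _ => le_max_left _ _) (norm_pos_iff.1 hc)
  · exact log_norm_le_circleAverage_log_of_norm_le hr hg hN hpos
      (fun z _ => le_max_right _ _) (norm_pos_iff.1 hc)

/-! ### Holomorphic extension of periodic real analytic functions -/

theorem AnalyticAt.exists_complex_extension {v : ℝ → ℝ} {x : ℝ} (h : AnalyticAt ℝ v x) :
    ∃ r > 0, ∃ g : ℂ → ℂ, AnalyticOnNhd ℂ g (Metric.ball (x : ℂ) r) ∧
      ∀ t : ℝ, |t - x| < r → g t = v t := by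
  obtain ⟨p, s, hp⟩ := h
  obtain ⟨r, hr0, hrs⟩ := ENNReal.lt_iff_exists_nnreal_btwn.1 hp.r_pos
  have hr0 : 0 < r := by exact_mod_cast hr0
  obtain ⟨C, -, hC⟩ := p.norm_mul_pow_le_of_lt_radius (hrs.trans_le hp.r_le)
  set q := FormalMultilinearSeries.ofScalars ℂ (fun n => (p.coeff n : ℂ)) with hq
  have hqr : (r : ENNReal) ≤ q.radius := by
    refine q.le_radius_of_bound C fun n => ?_
    rw [hq, FormalMultilinearSeries.ofScalars_norm, Complex.norm_real,
      ← FormalMultilinearSeries.norm_apply_eq_norm_coef]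
    exact hC n
  have hqs := q.hasFPowerSeriesOnBall (lt_of_lt_of_le (by exact_mod_cast hr0) hqr)
  refine ⟨r, by exact_mod_cast hr0, fun z => q.sum (z - x), fun z hz => ?_, fun t ht => ?_⟩
  · have hmem : z - x ∈ Metric.eball (0 : ℂ) q.radius := by
      refine Metric.eball_subset_eball hqr ?_
      rw [Metric.eball_coe]
      simpa [dist_eq_norm] using hz
    exact AnalyticAt.fun_comp (f := fun z : ℂ => z - x) (hqs.analyticOnNhd _ hmem) (by fun_prop)
  · have hmem : t - x ∈ Metric.eball (0 : ℝ) s := by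
      refine Metric.eball_subset_eball hrs.le ?_
      rw [Metric.eball_coe]
      simpa [dist_eq_norm] using ht
    have hsum := hp.hasSum hmem
    rw [add_sub_cancel] at hsum
    have hsum' := (Complex.hasSum_ofReal ).2 hsum
    show q.sum (t - x) = v t
    rw [FormalMultilinearSeries.sum, ← hsum'.tsum_eq]
    refine tsum_congr fun n => ?_
    rw [hq, FormalMultilinearSeries.ofScalars_apply_eq,
      FormalMultilinearSeries.apply_eq_pow_smul_coeff]
    simp [mul_comm]

/-- Two holomorphic functions on a connected open set which agree at its real points, of which
there is at least one, are equal. -/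
theorem AnalyticOnNhd.eqOn_of_eq_ofReal {f g : ℂ → ℂ} {U : Set ℂ} (hU : IsOpen U)
    (hUc : IsPreconnected U) (hf : AnalyticOnNhd ℂ f U) (hg : AnalyticOnNhd ℂ g U)
    {x : ℝ} (hx : (x : ℂ) ∈ U) (h : ∀ t : ℝ, (t : ℂ) ∈ U → f t = g t) : Set.EqOn f g U := by
  refine hf.eqOn_of_preconnected_of_frequently_eq hg hUc hx ?_
  have ht : Tendsto (fun t : ℝ => (t : ℂ)) (nhdsWithin x {x}ᶜ) (nhdsWithin (x : ℂ) {(x : ℂ)}ᶜ) := by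
    refine tendsto_nhdsWithin_of_tendsto_nhds_of_eventually_within _
      (Complex.continuous_ofReal.continuousAt.tendsto.mono_left nhdsWithin_le_nhds) ?_
    filter_upwards [self_mem_nhdsWithin] with t ht
    simpa using ht
  refine ht.frequently (Eventually.frequently ?_)
  have hU' : ∀ᶠ t : ℝ in nhds x, (t : ℂ) ∈ U :=
    Complex.continuous_ofReal.continuousAt.eventually_mem (hU.mem_nhds hx)
  exact (hU'.filter_mono nhdsWithin_le_nhds).mono fun t ht => h t ht

theorem exists_strip_extension {v : ℝ → ℝ} (hv : ∀ x, AnalyticAt ℝ v x)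
    (hper : ∀ x : ℝ, v (x + 1) = v x) :
    ∃ R > 0, ∃ V : ℂ → ℂ, AnalyticOnNhd ℂ V {z | |z.im| < R} ∧ (∀ x : ℝ, V x = v x) ∧
      Function.Periodic V 1 := by
  set P : ℝ → ℝ → Prop := fun r x => ∃ g : ℂ → ℂ, AnalyticOnNhd ℂ g (Metric.ball (x : ℂ) r) ∧
      ∀ t : ℝ, |t - x| < r → g t = v t with hP
  have hmono : ∀ r s x y : ℝ, s + |y - x| ≤ r → P r x → P s y := by
    rintro r s x y h ⟨g, hg, hgt⟩
    refine ⟨g, hg.mono (Metric.ball_subset_ball' ?_), fun t ht => hgt t ?_⟩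
    · rwa [Complex.dist_eq, ← Complex.ofReal_sub, Complex.norm_real]
    · have := abs_sub_le t y x
      linarith
  have hunif : ∃ R > 0, ∀ x ∈ Set.Icc (0 : ℝ) 1, P R x := by
    refine isCompact_Icc.induction_on (p := fun s => ∃ R > 0, ∀ x ∈ s, P R x)
      ⟨1, one_pos, by simp⟩ ?_ ?_ ?_
    · rintro s t hst ⟨R, hR, h⟩
      exact ⟨R, hR, fun x hx => h x (hst hx)⟩
    · rintro s t ⟨R, hR, h⟩ ⟨R', hR', h'⟩
      refine ⟨min R R', lt_min hR hR', ?_⟩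
      rintro x (hx | hx)
      · exact hmono R _ x x (by simp) (h x hx)
      · exact hmono R' _ x x (by simp) (h' x hx)
    · intro x _
      obtain ⟨r, hr, h⟩ := (hv x).exists_complex_extension
      refine ⟨Metric.ball x (r / 2),
        mem_nhdsWithin_of_mem_nhds (Metric.ball_mem_nhds x (by linarith)), r / 2, by linarith,
        fun y hy => hmono r _ x y ?_ h⟩
      rw [Metric.mem_ball, Real.dist_eq] at hy
      linarith
  obtain ⟨R, hR, hPR⟩ := hunif
  have hvper : Function.Periodic v 1 := hper
  have hall : ∀ x : ℝ, P R x := by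
    intro x
    obtain ⟨g, hg, hgt⟩ := hPR (Int.fract x) ⟨Int.fract_nonneg x, (Int.fract_lt_one x).le⟩
    have hfr : (Int.fract x : ℝ) = x - ⌊x⌋ := rfl
    refine ⟨fun z => g (z - (⌊x⌋ : ℝ)), fun z hz => ?_, fun t ht => ?_⟩
    · refine (hg _ ?_).fun_comp (by fun_prop)
      rw [Metric.mem_ball, Complex.dist_eq] at hz ⊢
      rw [hfr]
      convert hz using 2
      push_cast; ring
    · show g (t - (⌊x⌋ : ℝ)) = v t
      rw [← Complex.ofReal_sub, hgt _ (by rw [hfr]; convert ht using 2; ring)]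
      have := hvper.sub_int_mul_eq (x := t) ⌊x⌋
      rw [mul_one] at this
      rw [this]
  choose g hg hgt using hall
  have hmemball : ∀ (z : ℂ) (x : ℝ), z ∈ Metric.ball (x : ℂ) R ↔ ‖z - x‖ < R := by
    intro z x; rw [Metric.mem_ball, Complex.dist_eq]
  have hself : ∀ z : ℂ, |z.im| < R → z ∈ Metric.ball (z.re : ℂ) R := by
    intro z hz
    rw [hmemball]
    have : z - (z.re : ℂ) = z.im * Complex.I := by
      nth_rw 1 [← Complex.re_add_im z]; ring
    simpa [this] using hz
  have hagree : ∀ (z : ℂ) (x : ℝ), z ∈ Metric.ball (x : ℂ) R → g z.re z = g x z := by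
    intro z x hz
    have hre : |z.re - x| < R := by
      rw [hmemball] at hz
      simpa using (Complex.abs_re_le_norm (z - x)).trans_lt hz
    have him : |z.im| < R := by
      rw [hmemball] at hz
      simpa using (Complex.abs_im_le_norm (z - x)).trans_lt hz
    refine AnalyticOnNhd.eqOn_of_eq_ofReal (x := z.re)
      (U := Metric.ball (z.re : ℂ) R ∩ Metric.ball (x : ℂ) R)
      (Metric.isOpen_ball.inter Metric.isOpen_ball)
      ((convex_ball _ _).inter (convex_ball _ _)).isPreconnected
      ((hg z.re).mono Set.inter_subset_left) ((hg x).mono Set.inter_subset_right)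
      ⟨Metric.mem_ball_self hR, ?_⟩ (fun t ht => ?_) ⟨hself z him, hz⟩
    · rw [hmemball, ← Complex.ofReal_sub, Complex.norm_real]
      exact hre
    · have h1 := ht.1
      have h2 := ht.2
      rw [hmemball, ← Complex.ofReal_sub, Complex.norm_real] at h1 h2
      rw [hgt _ _ h1, hgt _ _ h2]
  refine ⟨R, hR, Set.indicator {z | |z.im| < R} fun z => g z.re z, fun z hz => ?_, fun x => ?_,
    fun z => ?_⟩
  · refine (hg z.re z (hself z hz)).congr ?_
    filter_upwards [Metric.isOpen_ball.mem_nhds (hself z hz),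
      (isOpen_lt (by fun_prop) continuous_const).mem_nhds hz] with w hw hw'
    rw [Set.indicator_of_mem (show w ∈ {z : ℂ | |z.im| < R} from hw')]
    exact (hagree w z.re hw).symm
  · rw [Set.indicator_of_mem (by simpa using hR)]
    exact hgt _ _ (by simpa using hR)
  · by_cases hz : |z.im| < R
    · rw [Set.indicator_of_mem (by simpa using hz), Set.indicator_of_mem (by simpa using hz)]
      refine AnalyticOnNhd.eqOn_of_eq_ofReal (x := z.re) (U := Metric.ball (z.re : ℂ) R)
        (f := fun w => g (z + 1).re (w + 1)) (g := g z.re) Metric.isOpen_ball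
        (convex_ball _ _).isPreconnected (fun w hw => ?_) (hg z.re)
        (Metric.mem_ball_self hR) (fun t ht => ?_) (hself z hz)
      · refine (hg _ _ ?_).fun_comp (by fun_prop)
        rw [hmemball] at hw ⊢
        convert hw using 2
        simp
      · rw [hmemball, ← Complex.ofReal_sub, Complex.norm_real] at ht
        have := hgt (z + 1).re (t + 1) (by simpa using ht)
        rw [hper t] at this
        rw [hgt _ _ ht, ← this]
        push_cast; rfl
    · rw [Set.indicator_of_notMem (by simpa using hz), Set.indicator_of_notMem (by simpa using hz)]

/-! ### Lines avoiding the level sets of a holomorphic function -/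

theorem Function.Periodic.apply_fract_add {V : ℂ → ℂ} (hper : Function.Periodic V 1) (x : ℝ)
    (w : ℂ) : V (Int.fract x + w) = V (x + w) := by
  have h := hper.sub_int_mul_eq (x := x + w) ⌊x⌋
  rw [← h, Int.fract]
  congr 1
  push_cast; ring

theorem isPreconnected_strip (R : ℝ) : IsPreconnected {z : ℂ | |z.im| < R} := by
  have : {z : ℂ | |z.im| < R} = Complex.imLm ⁻¹' Metric.ball 0 R := by ext z; simp
  rw [this]
  exact ((convex_ball (0 : ℝ) R).linear_preimage _).isPreconnected

theorem exists_line_ne {V : ℂ → ℂ} {R δ : ℝ} (hδ : 0 < δ) (hδR : δ < R)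
    (hV : AnalyticOnNhd ℂ V {z | |z.im| < R}) (hper : Function.Periodic V 1)
    (hne : ∃ x y : ℝ, V x ≠ V y) (E : ℂ) :
    ∃ y : ℝ, 0 < y ∧ y < δ ∧ ∀ x : ℝ, V (x + y * Complex.I) ≠ E := by
  by_contra! hcon
  have hzero : ∀ y : ℝ, ∃ x ∈ Set.Icc (0 : ℝ) 1, y ∈ Set.Ioo 0 δ → V (x + y * Complex.I) = E := by
    intro y
    by_cases hy : y ∈ Set.Ioo 0 δ
    · obtain ⟨x, hx⟩ := hcon y hy.1 hy.2
      exact ⟨Int.fract x, ⟨Int.fract_nonneg x, (Int.fract_lt_one x).le⟩, fun _ => by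
        rw [hper.apply_fract_add, hx]⟩
    · exact ⟨0, by simp, fun h => absurd h hy⟩
  choose X hX hXE using hzero
  set S : Set ℂ := (fun y : ℝ => (X y + y * Complex.I : ℂ)) '' Set.Ioo 0 δ with hS
  have hSinf : S.Infinite := by
    refine (Set.Ioo_infinite hδ).image fun a _ b _ h => ?_
    simpa using congrArg Complex.im h
  obtain ⟨z, hz, hacc⟩ := hSinf.exists_accPt_of_subset_isCompact
    (K := Set.Icc 0 1 ×ℂ Set.Icc 0 δ) (isCompact_Icc.reProdIm isCompact_Icc) (by
      rintro _ ⟨y, hy, rfl⟩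
      rw [Complex.mem_reProdIm]
      simpa using ⟨hX y, hy.1.le, hy.2.le⟩)
  rw [Complex.mem_reProdIm] at hz
  have hfreq : ∃ᶠ w in nhdsWithin z {z}ᶜ, V w = E := by
    refine (accPt_iff_frequently_nhdsNE.1 hacc).mono ?_
    rintro _ ⟨y, hy, rfl⟩
    exact hXE y hy
  have heq := hV.eqOn_of_preconnected_of_frequently_eq analyticOnNhd_const
    (isPreconnected_strip R)
    (show |z.im| < R by rw [abs_of_nonneg hz.2.1]; linarith [hz.2.2]) hfreq
  have hreal : ∀ x : ℝ, V x = E := fun x => heq (by simpa using hδ.trans hδR)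
  obtain ⟨x, y, hxy⟩ := hne
  exact hxy (by rw [hreal, hreal])

theorem exists_norm_le_on_strip {V : ℂ → ℂ} {R ρ : ℝ} (hρR : ρ < R)
    (hV : AnalyticOnNhd ℂ V {z | |z.im| < R}) (hper : Function.Periodic V 1) :
    ∃ C : ℝ, 0 < C ∧ ∀ z : ℂ, 0 ≤ z.im → z.im ≤ ρ → ‖V z‖ ≤ C := by
  obtain ⟨C, hC⟩ := (isCompact_Icc.reProdIm isCompact_Icc :
    IsCompact (Set.Icc 0 1 ×ℂ Set.Icc 0 ρ)).exists_bound_of_continuousOn (f := V)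
    (hV.continuousOn.mono fun z hz => by
      rw [Complex.mem_reProdIm] at hz
      show |z.im| < R
      rw [abs_of_nonneg hz.2.1]
      linarith [hz.2.2])
  refine ⟨max C 1, by positivity, fun z h0 h1 => le_max_of_le_left ?_⟩
  have h := hper.apply_fract_add z.re (z.im * Complex.I)
  rw [Complex.re_add_im] at h
  rw [← h]
  refine hC _ ?_
  rw [Complex.mem_reProdIm]
  exact ⟨by simpa using (Int.fract_lt_one z.re).le, by simpa using ⟨h0, h1⟩⟩

theorem exists_uniform_line_gap {V : ℂ → ℂ} {R δ : ℝ} (hδ : 0 < δ) (hδR : δ < R)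
    (hV : AnalyticOnNhd ℂ V {z | |z.im| < R}) (hper : Function.Periodic V 1)
    (hne : ∃ x y : ℝ, V x ≠ V y) (B : ℝ) :
    ∃ ε > 0, ∀ E : ℝ, |E| ≤ B → ∃ y : ℝ, 0 < y ∧ y < δ ∧
      ∀ x : ℝ, ε ≤ ‖E - V (x + y * Complex.I)‖ := by
  suffices ∃ ε > 0, ∀ E ∈ Set.Icc (-B) B, ∃ y : ℝ, 0 < y ∧ y < δ ∧
      ∀ x : ℝ, ε ≤ ‖E - V (x + y * Complex.I)‖ by
    obtain ⟨ε, hε, h⟩ := this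
    exact ⟨ε, hε, fun E hE => h E (abs_le.1 hE)⟩
  refine isCompact_Icc.induction_on (p := fun s : Set ℝ => ∃ ε > 0, ∀ E ∈ s, ∃ y : ℝ,
    0 < y ∧ y < δ ∧ ∀ x : ℝ, ε ≤ ‖E - V (x + y * Complex.I)‖) ⟨1, one_pos, by simp⟩ ?_ ?_ ?_
  · rintro s t hst ⟨ε, hε, h⟩
    exact ⟨ε, hε, fun E hE => h E (hst hE)⟩
  · rintro s t ⟨ε, hε, h⟩ ⟨ε', hε', h'⟩
    refine ⟨min ε ε', lt_min hε hε', ?_⟩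
    rintro E (hE | hE)
    · obtain ⟨y, hy0, hyδ, hy⟩ := h E hE
      exact ⟨y, hy0, hyδ, fun x => (min_le_left _ _).trans (hy x)⟩
    · obtain ⟨y, hy0, hyδ, hy⟩ := h' E hE
      exact ⟨y, hy0, hyδ, fun x => (min_le_right _ _).trans (hy x)⟩
  · intro E _
    obtain ⟨y, hy0, hyδ, hy⟩ := exists_line_ne hδ hδR hV hper hne E
    have hc : ContinuousOn (fun x : ℝ => ‖E - V (x + y * Complex.I)‖) (Set.Icc 0 1) := by
      refine (continuousOn_const.sub (hV.continuousOn.comp (by fun_prop) fun x _ => ?_)).norm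
      show |(x + y * Complex.I : ℂ).im| < R
      simpa [abs_of_pos hy0] using hyδ.trans hδR
    obtain ⟨x₀, -, hmin⟩ := isCompact_Icc.exists_isMinOn ⟨0, by simp⟩ hc
    set m := ‖E - V (x₀ + y * Complex.I)‖ with hm
    have hm0 : 0 < m := norm_pos_iff.2 (sub_ne_zero.2 (hy x₀).symm)
    refine ⟨Metric.ball E (m / 2), mem_nhdsWithin_of_mem_nhds
      (Metric.ball_mem_nhds E (by linarith)), m / 2, by linarith,
      fun E' hE' => ⟨y, hy0, hyδ, fun x => ?_⟩⟩
    have h1 : m ≤ ‖E - V (x + y * Complex.I)‖ := by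
      rw [← hper.apply_fract_add]
      exact hmin ⟨Int.fract_nonneg x, (Int.fract_lt_one x).le⟩
    have h2 : ‖(E : ℂ) - E'‖ < m / 2 := by
      rw [← Complex.ofReal_sub, Complex.norm_real, ← dist_eq_norm, dist_comm]
      exact hE'
    have h3 := norm_sub_le_norm_sub_add_norm_sub (E : ℂ) E' (V (x + y * Complex.I))
    linarith

/-! ### The complexified cocycle -/

/-- The first column of the `k`-step transfer matrix of the Schrödinger cocycle with potential
`lam * V`, at a complex phase `z`. -/
def orbit (V : ℂ → ℂ) (lam E ω : ℝ) (z : ℂ) : ℕ → ℂ × ℂ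
  | 0 => (1, 0)
  | k + 1 => ((E - lam * V (z + k * ω)) * (orbit V lam E ω z k).1 - (orbit V lam E ω z k).2,
      (orbit V lam E ω z k).1)

section Orbit

variable {V : ℂ → ℂ} {lam E ω : ℝ}

theorem orbit_norm_pos (z : ℂ) (k : ℕ) :
    0 < max ‖(orbit V lam E ω z k).1‖ ‖(orbit V lam E ω z k).2‖ := by
  suffices orbit V lam E ω z k ≠ 0 by
    rw [← Prod.norm_def]
    exact norm_pos_iff.2 this
  induction k with
  | zero => simp [orbit]
  | succ k ih =>
    contrapose! ih
    simp only [orbit, Prod.mk_eq_zero] at ih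
    have h2 : (orbit V lam E ω z k).2 = 0 := by simpa [ih.2] using ih.1
    exact Prod.ext ih.2 h2

theorem orbit_analyticOnNhd {R : ℝ} (hV : AnalyticOnNhd ℂ V {z | |z.im| < R}) (k : ℕ) :
    AnalyticOnNhd ℂ (fun z => (orbit V lam E ω z k).1) {z | |z.im| < R} ∧
      AnalyticOnNhd ℂ (fun z => (orbit V lam E ω z k).2) {z | |z.im| < R} := by
  induction k with
  | zero => exact ⟨analyticOnNhd_const, analyticOnNhd_const⟩
  | succ k ih =>
    refine ⟨?_, ih.1⟩
    have hshift : AnalyticOnNhd ℂ (fun z => V (z + k * ω)) {z | |z.im| < R} := by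
      intro z hz
      refine AnalyticAt.fun_comp (f := fun z : ℂ => z + k * ω) (hV _ ?_) (by fun_prop)
      show |(z + k * ω).im| < R
      have : (z + k * ω).im = z.im := by simp
      rw [this]
      exact hz
    exact ((analyticOnNhd_const.sub (analyticOnNhd_const.mul hshift)).mul ih.1).sub ih.2

theorem orbit_add_one (hper : Function.Periodic V 1) (z : ℂ) (k : ℕ) :
    orbit V lam E ω (z + 1) k = orbit V lam E ω z k := by
  induction k with
  | zero => rfl
  | succ k ih =>
    simp only [orbit, ih]
    rw [add_right_comm, hper]

theorem orbit_norm_le {z : ℂ} {K : ℝ} (hK : ∀ x : ℝ, ‖E - lam * V (z + x)‖ + 1 ≤ K) (k : ℕ) :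
    max ‖(orbit V lam E ω z k).1‖ ‖(orbit V lam E ω z k).2‖ ≤ K ^ k := by
  have hK1 : 1 ≤ K := by linarith [hK 0, norm_nonneg (E - lam * V (z + (0 : ℝ)))]
  induction k with
  | zero => simp [orbit]
  | succ k ih =>
    have h1 := (le_max_left _ _).trans ih
    have h2 := (le_max_right _ _).trans ih
    have hKk : 0 ≤ K ^ k := by positivity
    simp only [orbit]
    refine max_le ?_ (h1.trans (pow_le_pow_right₀ hK1 (Nat.le_succ k)))
    have hk := hK (k * ω)
    push_cast at hk
    calc _ ≤ ‖E - lam * V (z + k * ω)‖ * ‖(orbit V lam E ω z k).1‖ + ‖(orbit V lam E ω z k).2‖ := by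
          rw [← norm_mul]
          exact norm_sub_le _ _
      _ ≤ ‖E - lam * V (z + k * ω)‖ * K ^ k + K ^ k := by gcongr
      _ = (‖E - lam * V (z + k * ω)‖ + 1) * K ^ k := by ring
      _ ≤ K * K ^ k := by gcongr
      _ = K ^ (k + 1) := by ring

theorem le_orbit_norm {z : ℂ} {A : ℝ} (hA1 : 1 ≤ A)
    (hA : ∀ x : ℝ, A + 1 ≤ ‖E - lam * V (z + x)‖) (k : ℕ) :
    A ^ k ≤ max ‖(orbit V lam E ω z k).1‖ ‖(orbit V lam E ω z k).2‖ := by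
  suffices ‖(orbit V lam E ω z k).2‖ ≤ ‖(orbit V lam E ω z k).1‖ ∧
      A ^ k ≤ ‖(orbit V lam E ω z k).1‖ from le_max_of_le_left this.2
  induction k with
  | zero => simp [orbit]
  | succ k ih =>
    simp only [orbit]
    set a := (orbit V lam E ω z k).1
    set b := (orbit V lam E ω z k).2
    have hk := hA (k * ω)
    push_cast at hk
    have h : A * ‖a‖ ≤ ‖(E - lam * V (z + k * ω)) * a - b‖ := by
      have := norm_sub_norm_le ((E - lam * V (z + k * ω)) * a) b
      rw [norm_mul] at this
      nlinarith [norm_nonneg a, ih.1]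
    refine ⟨by nlinarith [norm_nonneg a], ?_⟩
    calc A ^ (k + 1) = A * A ^ k := by ring
      _ ≤ A * ‖a‖ := by gcongr; exact ih.2
      _ ≤ _ := h

/-- The projection of `ℂ` onto the closed strip `0 ≤ im z ≤ ρ`. -/
def stripProj (ρ : ℝ) (z : ℂ) : ℂ := z.re + (max 0 (min z.im ρ) : ℝ) * Complex.I

theorem continuous_stripProj (ρ : ℝ) : Continuous (stripProj ρ) := by
  unfold stripProj
  fun_prop

theorem stripProj_of_mem {ρ : ℝ} {z : ℂ} (h0 : 0 ≤ z.im) (h1 : z.im ≤ ρ) : stripProj ρ z = z := by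
  rw [stripProj, min_eq_left h1, max_eq_right h0, Complex.re_add_im]

theorem stripProj_mem {ρ : ℝ} (hρ : 0 < ρ) (z : ℂ) :
    0 ≤ (stripProj ρ z).im ∧ (stripProj ρ z).im ≤ ρ := by
  simp [stripProj, hρ.le]

theorem stripProj_add_one (ρ : ℝ) (z : ℂ) : stripProj ρ (z + 1) = stripProj ρ z + 1 := by
  simp only [stripProj, Complex.add_re, Complex.add_im, Complex.one_re, Complex.one_im, add_zero]
  push_cast; ring

theorem mul_log_le_integral_log_orbit {R ρ : ℝ} (hρ : 0 < ρ) (hρR : ρ < R)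
    (hV : AnalyticOnNhd ℂ V {z | |z.im| < R}) (hper : Function.Periodic V 1) {K A y : ℝ}
    (hK : ∀ z : ℂ, 0 ≤ z.im → z.im ≤ ρ → ‖E - lam * V z‖ + 1 ≤ K) (hA1 : 1 ≤ A)
    (hy0 : 0 ≤ y) (hyρ : y ≤ ρ / 2)
    (hA : ∀ x : ℝ, A + 1 ≤ ‖E - lam * V (x + y * Complex.I)‖) (k : ℕ) :
    k * (2 * Real.log A - Real.log K) ≤ ∫ x in (0 : ℝ)..1,
      Real.log (max ‖(orbit V lam E ω x k).1‖ ‖(orbit V lam E ω x k).2‖) := by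
  set N : ℂ → ℝ := fun z => max ‖(orbit V lam E ω z k).1‖ ‖(orbit V lam E ω z k).2‖ with hN
  have hNpos : ∀ z, 0 < N z := fun z => orbit_norm_pos z k
  obtain ⟨hf, hg⟩ := orbit_analyticOnNhd (lam := lam) (E := E) (ω := ω) hV k
  have hNc : ContinuousOn N {z | |z.im| < R} :=
    ContinuousOn.sup hf.continuousOn.norm hg.continuousOn.norm
  set u : ℂ → ℝ := fun z => Real.log (N (stripProj ρ z)) with hu
  have hstrip : ∀ z : ℂ, 0 ≤ z.im → z.im ≤ ρ → |z.im| < R := fun z h0 h1 => by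
    rw [abs_of_nonneg h0]; linarith
  have huc : Continuous u := by
    refine Continuous.log ?_ fun z => (hNpos _).ne'
    exact hNc.comp_continuous (continuous_stripProj ρ) fun z =>
      hstrip _ (stripProj_mem hρ z).1 (stripProj_mem hρ z).2
  have huper : ∀ z, u (z + 1) = u z := by
    intro z
    simp only [hu, hN]
    rw [stripProj_add_one, orbit_add_one hper]
  have hueq : ∀ z : ℂ, 0 ≤ z.im → z.im ≤ ρ → u z = Real.log (N z) := fun z h0 h1 => by
    simp only [hu]; rw [stripProj_of_mem h0 h1]
  have hsub : ∀ (c : ℂ) (r : ℝ), 0 < r → r ≤ c.im → r ≤ ρ - c.im →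
      u c ≤ Real.circleAverage u c r := by
    intro c r hr h1 h2
    have hball : ∀ z ∈ Metric.closedBall c r, 0 ≤ z.im ∧ z.im ≤ ρ := by
      intro z hz
      rw [Metric.mem_closedBall, Complex.dist_eq] at hz
      have := abs_le.1 ((Complex.abs_im_le_norm (z - c)).trans hz)
      rw [Complex.sub_im] at this
      constructor <;> linarith [this.1, this.2]
    have hsubset : Metric.closedBall c r ⊆ {z | |z.im| < R} := fun z hz =>
      hstrip z (hball z hz).1 (hball z hz).2
    have hcc := hball c (Metric.mem_closedBall_self hr.le)
    rw [hueq c hcc.1 hcc.2, Real.circleAverage_congr_sphere (f₂ := fun z => Real.log (N z))]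
    · exact log_max_norm_le_circleAverage hr (hf.mono hsubset) (hg.mono hsubset)
        fun z _ => hNpos z
    · intro z hz
      rw [abs_of_pos hr] at hz
      have := hball z (Metric.sphere_subset_closedBall hz)
      exact hueq z this.1 this.2
  have hchord := horizontal_mean_le_chord huc huper hρ hsub hy0 (by linarith : y ≤ ρ)
  have him : ∀ x t : ℝ, (x + t * Complex.I : ℂ).im = t := by simp
  have hAK : A ≤ K := by
    have h1 := hA 0
    have h2 := hK ((0 : ℝ) + y * Complex.I) (by rw [him]; exact hy0) (by rw [him]; linarith)
    linarith
  have hlow : k * Real.log A ≤ ∫ x in (0 : ℝ)..1, u (x + y * Complex.I) := by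
    have : ∫ x in (0 : ℝ)..1, k * Real.log A ≤ ∫ x in (0 : ℝ)..1, u (x + y * Complex.I) := by
      refine intervalIntegral.integral_mono_on zero_le_one (by simp)
        (by apply Continuous.intervalIntegrable; fun_prop) fun x _ => ?_
      rw [hueq _ (by rw [him]; exact hy0) (by rw [him]; linarith), ← Real.log_pow]
      refine Real.log_le_log (by positivity) (le_orbit_norm hA1 (fun t => ?_) k)
      have := hA (x + t)
      push_cast at this
      rwa [add_right_comm] at this
    simpa using this
  have hup : ∫ x in (0 : ℝ)..1, u (x + ρ * Complex.I) ≤ k * Real.log K := by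
    have : ∫ x in (0 : ℝ)..1, u (x + ρ * Complex.I) ≤ ∫ x in (0 : ℝ)..1, k * Real.log K := by
      refine intervalIntegral.integral_mono_on zero_le_one
        (by apply Continuous.intervalIntegrable; fun_prop) (by simp) fun x _ => ?_
      rw [hueq _ (by rw [him]; exact hρ.le) (by rw [him]), ← Real.log_pow]
      refine Real.log_le_log (hNpos _) (orbit_norm_le (fun t => hK _ ?_ ?_) k) <;> simp [hρ.le]
    simpa using this
  have hreal : ∫ x in (0 : ℝ)..1, u x = ∫ x in (0 : ℝ)..1, Real.log (N x) := by
    congr 1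
    ext x
    exact hueq x (by simp) (by simpa using hρ.le)
  rw [hreal] at hchord
  set t := y / ρ with ht
  have ht0 : 0 ≤ t := by positivity
  have ht1 : t ≤ 1 / 2 := by rw [ht, div_le_iff₀ hρ]; linarith
  have hlog : Real.log A ≤ Real.log K := Real.log_le_log (by linarith) hAK
  set I := ∫ x in (0 : ℝ)..1, Real.log (N x)
  have h1 : (1 - t) * (k * (2 * Real.log A - Real.log K)) ≤ (1 - t) * I := by
    have h2 : t * ∫ x in (0 : ℝ)..1, u (x + ρ * Complex.I) ≤ t * (k * Real.log K) := by gcongr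
    have h3 : 0 ≤ k * ((Real.log K - Real.log A) * (1 - 2 * t)) := by
      refine mul_nonneg k.cast_nonneg (mul_nonneg ?_ ?_) <;> linarith
    linarith
  exact le_of_mul_le_mul_left h1 (by linarith)

end Orbit

/-! ### The real cocycle -/

section Transfer

variable {v : ℝ → ℝ} {lam E ω : ℝ}

theorem matNorm_mul_le (M N : Matrix (Fin 2) (Fin 2) ℝ) :
    matNorm (M * N) ≤ matNorm M * matNorm N := by
  rw [matNorm, matNorm, matNorm, ← Real.sqrt_mul (by positivity)]
  refine Real.sqrt_le_sqrt ?_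
  simp only [Fin.sum_univ_two, Matrix.mul_apply]
  linarith [sq_nonneg (M 0 0 * N 1 0 - M 0 1 * N 0 0), sq_nonneg (M 0 0 * N 1 1 - M 0 1 * N 0 1),
    sq_nonneg (M 1 0 * N 1 0 - M 1 1 * N 0 0), sq_nonneg (M 1 0 * N 1 1 - M 1 1 * N 0 1)]

theorem abs_entry_le_matNorm (M : Matrix (Fin 2) (Fin 2) ℝ) (i j : Fin 2) :
    |M i j| ≤ matNorm M := by
  refine Real.abs_le_sqrt ?_
  calc (M i j) ^ 2 ≤ ∑ j, (M i j) ^ 2 :=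
        Finset.single_le_sum (f := fun j => (M i j) ^ 2) (fun _ _ => sq_nonneg _)
          (Finset.mem_univ j)
    _ ≤ ∑ i, ∑ j, (M i j) ^ 2 :=
        Finset.single_le_sum (f := fun i => ∑ j, (M i j) ^ 2)
          (fun _ _ => Finset.sum_nonneg fun _ _ => sq_nonneg _) (Finset.mem_univ i)

theorem transfer_add (θ : ℝ) (m n : ℕ) :
    transfer v lam E ω θ (m + n) =
      transfer v lam E ω (θ + n * ω) m * transfer v lam E ω θ n := by
  induction m with
  | zero => simp [transfer]
  | succ m ih =>
    rw [Nat.succ_add]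
    simp only [transfer]
    have h : θ + ((m + n : ℕ) : ℝ) * ω = θ + n * ω + m * ω := by push_cast; ring
    rw [ih, Matrix.mul_assoc, h]

theorem transfer_add_one (hper : ∀ x, v (x + 1) = v x) (θ : ℝ) (k : ℕ) :
    transfer v lam E ω (θ + 1) k = transfer v lam E ω θ k := by
  induction k with
  | zero => rfl
  | succ k ih =>
    simp only [transfer, ih]
    rw [add_right_comm, hper]

theorem continuous_transfer (hv : Continuous v) (k : ℕ) :
    Continuous fun θ => transfer v lam E ω θ k := by
  induction k with
  | zero => exact continuous_const
  | succ k ih =>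
    refine Continuous.matrix_mul (continuous_matrix fun i j => ?_) ih
    fin_cases i <;> fin_cases j <;> simp <;> fun_prop

theorem continuous_matNorm : Continuous matNorm := by
  unfold matNorm
  fun_prop

theorem orbit_ofReal {V : ℂ → ℂ} (hV : ∀ x : ℝ, V x = v x) (θ : ℝ) (k : ℕ) :
    orbit V lam E ω θ k =
      ((transfer v lam E ω θ k 0 0 : ℂ), (transfer v lam E ω θ k 1 0 : ℂ)) := by
  induction k with
  | zero => simp [orbit, transfer]
  | succ k ih =>
    have h := hV (θ + k * ω)
    push_cast at h
    simp [orbit, transfer, ih, h, Matrix.mul_apply, Fin.sum_univ_two, sub_eq_add_neg]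

theorem orbit_norm_le_matNorm {V : ℂ → ℂ} (hV : ∀ x : ℝ, V x = v x) (θ : ℝ) (k : ℕ) :
    max ‖(orbit V lam E ω θ k).1‖ ‖(orbit V lam E ω θ k).2‖ ≤ matNorm (transfer v lam E ω θ k) := by
  rw [orbit_ofReal hV]
  simp only [Complex.norm_real, Real.norm_eq_abs]
  exact max_le (abs_entry_le_matNorm _ _ _) (abs_entry_le_matNorm _ _ _)

theorem matNorm_transfer_pos (θ : ℝ) (k : ℕ) : 0 < matNorm (transfer v lam E ω θ k) :=
  (orbit_norm_pos (V := fun z => v z.re) (θ : ℂ) k).trans_le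
    (orbit_norm_le_matNorm (by simp) θ k)

theorem continuous_log_matNorm_transfer (hv : Continuous v) (k : ℕ) :
    Continuous fun θ => Real.log (matNorm (transfer v lam E ω θ k)) :=
  (continuous_matNorm.comp (continuous_transfer hv k)).log fun θ => (matNorm_transfer_pos θ k).ne'

/-- Linear lower bounds on the mean log-norms pass to the Lyapunov exponent, which exists by
Fekete's lemma. -/
theorem exists_hasLyapunov_of_le (hv : Continuous v) (hper : ∀ x, v (x + 1) = v x) {c : ℝ}
    (hc : ∀ k : ℕ, k * c ≤
      ∫ θ in (0 : ℝ)..1, Real.log (matNorm (transfer v lam E ω θ k))) :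
    ∃ γ, HasLyapunov v lam E ω γ ∧ c ≤ γ := by
  set a : ℕ → ℝ := fun k => ∫ θ in (0 : ℝ)..1, Real.log (matNorm (transfer v lam E ω θ k)) with ha
  have hcont := fun k => continuous_log_matNorm_transfer (lam := lam) (E := E) (ω := ω) hv k
  have hsub : Subadditive a := by
    intro m n
    have hp : Function.Periodic (fun θ => Real.log (matNorm (transfer v lam E ω θ m))) 1 :=
      fun θ => by simp only; rw [transfer_add_one hper]
    have hshift : ∫ θ in (0 : ℝ)..1, Real.log (matNorm (transfer v lam E ω (θ + n * ω) m)) =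
        a m := by
      rw [intervalIntegral.integral_comp_add_right
        (fun θ => Real.log (matNorm (transfer v lam E ω θ m)))]
      have := hp.intervalIntegral_add_eq (n * ω) 0
      rw [zero_add] at this
      rw [zero_add, add_comm 1, this]
    have hi : ∀ k (s : ℝ), IntervalIntegrable
        (fun θ => Real.log (matNorm (transfer v lam E ω (θ + s) k))) volume 0 1 := fun k s =>
      ((hcont k).comp (continuous_add_const s)).intervalIntegrable _ _
    have hi0 := fun k => (hcont k).intervalIntegrable (μ := volume) 0 1
    rw [← hshift, ha, ← intervalIntegral.integral_add (hi m _) (hi0 n)]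
    refine intervalIntegral.integral_mono_on zero_le_one (hi0 _) ((hi m _).add (hi0 n))
      fun θ _ => ?_
    rw [← Real.log_mul (matNorm_transfer_pos _ _).ne' (matNorm_transfer_pos _ _).ne',
      transfer_add]
    exact Real.log_le_log (transfer_add (v := v) θ m n ▸ matNorm_transfer_pos θ (m + n))
      (matNorm_mul_le _ _)
  have hle : ∀ k : ℕ, k ≠ 0 → c ≤ a k / k := fun k hk => by
    rw [le_div_iff₀ (by positivity), mul_comm]
    exact hc k
  have hbdd : BddBelow (Set.range fun k => a k / k) := by
    refine ⟨min c 0, ?_⟩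
    rintro _ ⟨k, rfl⟩
    rcases eq_or_ne k 0 with rfl | hk
    · simp
    · exact (min_le_left _ _).trans (hle k hk)
  have hlim := hsub.tendsto_lim hbdd
  refine ⟨hsub.lim, ?_, ge_of_tendsto hlim ?_⟩
  · refine hlim.congr fun k => ?_
    rw [ha, integral_Icc_eq_integral_Ioc, ← intervalIntegral.integral_of_le zero_le_one,
      div_eq_inv_mul, one_div]
  · filter_upwards [eventually_ne_atTop 0] with k hk using hle k hk

theorem continuous_log_orbit_norm (hv : Continuous v) {V : ℂ → ℂ} (hV : ∀ x : ℝ, V x = v x)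
    (k : ℕ) : Continuous fun x : ℝ =>
      Real.log (max ‖(orbit V lam E ω x k).1‖ ‖(orbit V lam E ω x k).2‖) := by
  have ho : Continuous fun x : ℝ => orbit V lam E ω x k := by
    simp_rw [orbit_ofReal hV]
    have := continuous_transfer (lam := lam) (E := E) (ω := ω) hv k
    fun_prop
  exact (ho.fst.norm.max ho.snd.norm).log fun x => (orbit_norm_pos _ k).ne'

theorem exists_hasLyapunov_of_le_orbit (hv : Continuous v) (hper : ∀ x, v (x + 1) = v x)
    {V : ℂ → ℂ} (hV : ∀ x : ℝ, V x = v x) {c : ℝ}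
    (hc : ∀ k : ℕ, k * c ≤ ∫ x in (0 : ℝ)..1,
      Real.log (max ‖(orbit V lam E ω x k).1‖ ‖(orbit V lam E ω x k).2‖)) :
    ∃ γ, HasLyapunov v lam E ω γ ∧ c ≤ γ :=
  exists_hasLyapunov_of_le hv hper fun k => (hc k).trans <|
    intervalIntegral.integral_mono_on zero_le_one
      ((continuous_log_orbit_norm hv hV k).intervalIntegrable _ _)
      ((continuous_log_matNorm_transfer hv k).intervalIntegrable _ _) fun x _ =>
        Real.log_le_log (orbit_norm_pos _ k) (orbit_norm_le_matNorm hV x k)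

end Transfer

/-- **Sorets–Spencer**: for a nonconstant real analytic 1-periodic `v : ℝ → ℝ` there is
`λ₀(v)` such that for all `λ > λ₀`, all irrational `ω` and all energies `E`, the Lyapunov
exponent satisfies `γ(E) > (1/2) log λ`. -/
theorem lyapunov_positive_large_coupling_one_frequency
    (v : ℝ → ℝ)
    (hv_an : ∀ x, AnalyticAt ℝ v x)
    (hv_per : ∀ x : ℝ, v (x + 1) = v x)
    (hv_nonconst : ∃ x y, v x ≠ v y) :
    ∃ lam₀ : ℝ, ∀ lam : ℝ, lam₀ < lam → ∀ ω : ℝ, Irrational ω → ∀ E : ℝ,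
      ∃ γ : ℝ, HasLyapunov v lam E ω γ ∧ (1 / 2) * Real.log lam < γ := by
  obtain ⟨R, hR, V, hV, hVv, hVper⟩ := exists_strip_extension hv_an hv_per
  have hv : Continuous v := continuous_iff_continuousAt.2 fun x => (hv_an x).continuousAt
  obtain ⟨C, hC0, hC⟩ := exists_norm_le_on_strip (ρ := R / 2) (by linarith) hV hVper
  have hne : ∃ x y : ℝ, V x ≠ V y := by
    obtain ⟨x, y, hxy⟩ := hv_nonconst
    exact ⟨x, y, by rw [hVv, hVv]; exact_mod_cast hxy⟩
  obtain ⟨ε, hε, hgap⟩ := exists_uniform_line_gap (δ := R / 4) (by linarith) (by linarith)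
    hV hVper hne (C + 2)
  set K := 2 * C + 3 with hK
  refine ⟨max (max 1 (2 / ε)) (Real.exp (2 * Real.log K - 4 * Real.log (ε / 2))),
    fun lam hlam ω _ E => ?_⟩
  obtain ⟨⟨h1, h2⟩, h3⟩ : (1 < lam ∧ 2 / ε < lam) ∧ _ := by
    simpa only [max_lt_iff] using hlam
  have hlam0 : 0 < lam := one_pos.trans h1
  rw [div_lt_iff₀ hε] at h2
  rw [← Real.lt_log_iff_exp_lt hlam0] at h3
  have hlog : 0 < Real.log lam := Real.log_pos h1
  have hfactor : ∀ z, ‖(E : ℂ) - lam * V z‖ = lam * ‖((E / lam : ℝ) : ℂ) - V z‖ := by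
    intro z
    have hl : (lam : ℂ) ≠ 0 := by exact_mod_cast hlam0.ne'
    rw [← Complex.norm_of_nonneg hlam0.le, ← norm_mul, Complex.norm_of_nonneg hlam0.le]
    congr 1
    push_cast
    field_simp
  rcases le_or_gt |E / lam| (C + 2) with hE | hE
  · obtain ⟨y, hy0, hyR, hy⟩ := hgap (E / lam) hE
    have hup : ∀ z : ℂ, 0 ≤ z.im → z.im ≤ R / 2 → ‖E - lam * V z‖ + 1 ≤ lam * K := by
      intro z hz0 hz1
      have := norm_sub_le ((E / lam : ℝ) : ℂ) (V z)
      rw [Complex.norm_real, Real.norm_eq_abs] at this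
      rw [hfactor]
      nlinarith [hC z hz0 hz1]
    have hlow : ∀ x : ℝ, lam * ε / 2 + 1 ≤ ‖E - lam * V (x + y * Complex.I)‖ := by
      intro x
      rw [hfactor]
      nlinarith [hy x]
    obtain ⟨γ, hγ, hle⟩ := exists_hasLyapunov_of_le_orbit hv hv_per hVv
      (mul_log_le_integral_log_orbit (ω := ω) (by linarith) (by linarith) hV hVper hup
        (by linarith) hy0.le (by linarith) hlow)
    refine ⟨γ, hγ, lt_of_lt_of_le ?_ hle⟩
    rw [mul_div_assoc, Real.log_mul hlam0.ne' (by positivity),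
      Real.log_mul hlam0.ne' (by positivity)]
    linarith
  · have hfar : ∀ x : ℝ, lam + 1 ≤ ‖E - lam * V x‖ := by
      intro x
      have h4 := norm_sub_norm_le ((E / lam : ℝ) : ℂ) (V x)
      rw [Complex.norm_real, Real.norm_eq_abs] at h4
      have h5 := hC x (by simp) (by simp only [Complex.ofReal_im]; positivity)
      rw [hfactor]
      nlinarith
    have hlow : ∀ k : ℕ, k * Real.log lam ≤ ∫ x in (0 : ℝ)..1,
        Real.log (max ‖(orbit V lam E ω x k).1‖ ‖(orbit V lam E ω x k).2‖) := by
      intro k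
      have hle : ∫ x in (0 : ℝ)..1, k * Real.log lam ≤ ∫ x in (0 : ℝ)..1,
          Real.log (max ‖(orbit V lam E ω x k).1‖ ‖(orbit V lam E ω x k).2‖) := by
        refine intervalIntegral.integral_mono_on zero_le_one (by simp)
          ((continuous_log_orbit_norm hv hVv k).intervalIntegrable _ _) fun x _ => ?_
        rw [← Real.log_pow]
        refine Real.log_le_log (by positivity) (le_orbit_norm h1.le (fun t => ?_) k)
        exact_mod_cast hfar (x + t)
      simpa using hle
    obtain ⟨γ, hγ, hle⟩ := exists_hasLyapunov_of_le_orbit hv hv_per hVv hlow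
    exact ⟨γ, hγ, by linarith⟩
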